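/- Let S ⊆ ℝ² be finite and in general position. Then for all s, t ∈ S there is a path from s to t in the TD_{θ₁,θ₂}-Delaunay graph G of S (in particular G is connected), and d_G(s,t) ≤ max( 1/sin(θ₁/2), C(θ₁,θ₂) )·‖s − t‖. -/

import Mathlib

noncomputable section

/-- The Euclidean plane. -/
abbrev Pt : Type := EuclideanSpace ℝ (Fin 2)

/-- The scaled translate `r•Δ + w` of a set `Δ`. -/
def scaledTranslate (Δ : Set Pt) (r : ℝ) (w : Pt) : Set Pt :=
  (fun x => r • x + w) '' Δ

/-- The triangle with corners `τ 0, τ 1, τ 2`. -/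
def Tri (τ : Fin 3 → Pt) : Set Pt := convexHull ℝ (Set.range τ)

/-- Adjacency in the `Δ`-Delaunay graph of `S`: distinct `u, v ∈ S` are adjacent exactly
when some scaled translate of `Δ` has `u` and `v` on its boundary and no point of `S`
in its interior. -/
def TDAdj (Δ : Set Pt) (S : Set Pt) (u v : Pt) : Prop :=
  u ∈ S ∧ v ∈ S ∧ u ≠ v ∧
    ∃ r : ℝ, 0 < r ∧ ∃ w : Pt,
      u ∈ frontier (scaledTranslate Δ r w) ∧
      v ∈ frontier (scaledTranslate Δ r w) ∧
      ∀ x ∈ S, x ∉ interior (scaledTranslate Δ r w)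

/-- Length of a polygonal path given as a list of vertices. -/
def pathLength : List Pt → ℝ
  | [] => 0
  | [_] => 0
  | a :: b :: rest => ‖a - b‖ + pathLength (b :: rest)

/-- `P` is a path in the graph with adjacency `Adj` from `a` to `b`. -/
def IsPathFrom (Adj : Pt → Pt → Prop) (a b : Pt) (P : List Pt) : Prop :=
  P ≠ [] ∧ P.head? = some a ∧ P.getLast? = some b ∧ P.Chain' Adj

/-- Graph distance: infimum of lengths of paths from `u` to `v`. -/
def dG (Adj : Pt → Pt → Prop) (u v : Pt) : ℝ :=
  sInf { L : ℝ | ∃ P : List Pt, IsPathFrom Adj u v P ∧ pathLength P = L }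

/-- `S` is in general position: no two points of `S` determine a line parallel to a side
of the triangle with corners `τ 0, τ 1, τ 2`. -/
def GenPos (τ : Fin 3 → Pt) (S : Set Pt) : Prop :=
  ∀ u ∈ S, ∀ v ∈ S, u ≠ v → ∀ i : Fin 3, ∀ c : ℝ, v - u ≠ c • (τ (i + 1) - τ i)

/-- The inner expression in the definition of `C(θ₁,θ₂)`. -/
def Cexpr (θ : Fin 3 → ℝ) (j : Fin 3) (α : ℝ) : ℝ :=
  Real.sin (θ j - α) / Real.sin (θ (j + 1)) + Real.sin α / Real.sin (θ (j - 1)) +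
    min (Real.sin α / Real.sin (θ (j - 1)) + Real.sin (α + θ (j - 1)) / Real.sin (θ (j + 1)))
        (Real.sin (θ j - α) / Real.sin (θ (j + 1)) +
          Real.sin (α + θ (j - 1)) / Real.sin (θ (j - 1)))

/-- `C(θ₁,θ₂)`: the maximum of `Cexpr θ j α` over `j ∈ {1,2,3}` and `α ∈ [0, θⱼ]`. -/
def Cval (θ : Fin 3 → ℝ) : ℝ :=
  sSup { x : ℝ | ∃ j : Fin 3, ∃ α : ℝ, α ∈ Set.Icc 0 (θ j) ∧ x = Cexpr θ j α }

/-- The positive cone `C_{p,i}`. -/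
def posCone (τ : Fin 3 → Pt) (p : Pt) (i : Fin 3) : Set Pt :=
  { q | ∃ s r : ℝ, 0 ≤ s ∧ 0 ≤ r ∧ q = p + s • (τ (i + 1) - τ i) + r • (τ (i - 1) - τ i) }

/-- The negative cone `C̄_{p,i}`. -/
def negCone (τ : Fin 3 → Pt) (p : Pt) (i : Fin 3) : Set Pt :=
  { q | ∃ s r : ℝ, 0 ≤ s ∧ 0 ≤ r ∧ q = p - s • (τ (i + 1) - τ i) - r • (τ (i - 1) - τ i) }

/-- Vertices reachable from `s` by a path with at most `k` edges. -/
def ReachK (Adj : Pt → Pt → Prop) (k : ℕ) (s : Pt) : Set Pt :=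
  { v | ∃ P : List Pt, IsPathFrom Adj s v P ∧ P.length ≤ k + 1 }

/-! ### Auxiliary material for the proof -/

/-- `A, B, C` is a permutation of the corners of the triangle. -/
def Good (τ : Fin 3 → Pt) (A B C : Pt) : Prop :=
  ∃ i j k : Fin 3, i ≠ j ∧ j ≠ k ∧ i ≠ k ∧ A = τ i ∧ B = τ j ∧ C = τ k

lemma Good.swap12 {τ : Fin 3 → Pt} {A B C : Pt} (h : Good τ A B C) : Good τ B A C := by
  obtain ⟨i, j, k, h1, h2, h3, rfl, rfl, rfl⟩ := h
  exact ⟨j, i, k, h1.symm, h3, h2, rfl, rfl, rfl⟩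

lemma Good.swap23 {τ : Fin 3 → Pt} {A B C : Pt} (h : Good τ A B C) : Good τ A C B := by
  obtain ⟨i, j, k, h1, h2, h3, rfl, rfl, rfl⟩ := h
  exact ⟨i, k, j, h3, h2.symm, h1, rfl, rfl, rfl⟩

lemma Good.range {τ : Fin 3 → Pt} {A B C : Pt} (h : Good τ A B C) :
    Set.range τ = {A, B, C} := by
  obtain ⟨i, j, k, h1, h2, h3, rfl, rfl, rfl⟩ := h
  ext x
  simp only [Set.mem_range, Set.mem_insert_iff, Set.mem_singleton_iff]
  constructor
  · rintro ⟨y, rfl⟩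
    have : y = i ∨ y = j ∨ y = k := by omega
    rcases this with rfl | rfl | rfl <;> simp
  · rintro (rfl | rfl | rfl) <;> exact ⟨_, rfl⟩

lemma Good.indep {τ : Fin 3 → Pt} {A B C : Pt} (h : Good τ A B C)
    (hn : ¬ Collinear ℝ (Set.range τ)) (a b : ℝ)
    (hab : a • (B - A) + b • (C - A) = 0) : a = 0 ∧ b = 0 := by
  rw [h.range, collinear_iff_of_mem (p₀ := A) (by simp)] at hn
  by_contra hcon
  apply hn
  by_cases ha : a = 0
  · have hb : b ≠ 0 := fun hb => hcon ⟨ha, hb⟩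
    have h2 : C - A = 0 := by
      subst ha
      simpa [hb] using hab
    refine ⟨B - A, ?_⟩
    simp only [Set.mem_insert_iff, Set.mem_singleton_iff, vadd_eq_add]
    rintro x (rfl | rfl | rfl)
    · exact ⟨0, by simp⟩
    · exact ⟨1, by simp⟩
    · exact ⟨0, by simpa [sub_eq_zero] using h2⟩
  · have h2 : B - A = (-(b / a)) • (C - A) := by
      have : a • (B - A) = a • ((-(b / a)) • (C - A)) := by
        rw [smul_smul, show a * -(b / a) = -b by field_simp, neg_smul]
        exact eq_neg_of_add_eq_zero_left hab
      exact smul_right_injective _ ha this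
    refine ⟨C - A, ?_⟩
    simp only [Set.mem_insert_iff, Set.mem_singleton_iff, vadd_eq_add]
    rintro x (rfl | rfl | rfl)
    · exact ⟨0, by simp⟩
    · exact ⟨_, by rw [← h2]; simp⟩
    · exact ⟨1, by simp⟩

lemma Good.span {τ : Fin 3 → Pt} {A B C : Pt} (h : Good τ A B C)
    (hn : ¬ Collinear ℝ (Set.range τ)) (x : Pt) :
    ∃ a b : ℝ, x = a • (B - A) + b • (C - A) := by
  have hi := h.indep hn
  generalize B - A = p at *
  generalize C - A = q at *
  have hD : p 0 * q 1 - p 1 * q 0 ≠ 0 := by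
    intro hD
    have e1 := hi (q 0) (-p 0) (by
      ext i; fin_cases i <;> simp <;> linarith)
    have e2 := hi (q 1) (-p 1) (by
      ext i; fin_cases i <;> simp <;> linarith)
    have e3 := hi 1 0 (by
      ext i; fin_cases i <;> simp <;> linarith [e1.2, e2.2])
    exact one_ne_zero e3.1
  refine ⟨(x 0 * q 1 - x 1 * q 0) / (p 0 * q 1 - p 1 * q 0),
    (p 0 * x 1 - p 1 * x 0) / (p 0 * q 1 - p 1 * q 0), ?_⟩
  ext i
  fin_cases i
  · simp only [Fin.zero_eta, PiLp.add_apply, PiLp.smul_apply, smul_eq_mul]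
    rw [div_mul_eq_mul_div, div_mul_eq_mul_div, ← add_div, eq_div_iff hD]
    ring
  · simp only [Fin.mk_one, PiLp.add_apply, PiLp.smul_apply, smul_eq_mul]
    rw [div_mul_eq_mul_div, div_mul_eq_mul_div, ← add_div, eq_div_iff hD]
    ring

lemma Good.gp {τ : Fin 3 → Pt} {A B C : Pt} (h : Good τ A B C) {S : Set Pt}
    (hgp : GenPos τ S) {u v : Pt} (hu : u ∈ S) (hv : v ∈ S) (huv : u ≠ v) (c : ℝ) :
    v - u ≠ c • (B - A) := by
  obtain ⟨i, j, k, h1, h2, h3, rfl, rfl, rfl⟩ := h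
  have : j = i + 1 ∨ i = j + 1 := by
    revert i j k; decide
  rcases this with rfl | rfl
  · exact hgp u hu v hv huv i c
  · intro hc
    apply hgp u hu v hv huv j (-c)
    rw [hc]; module

lemma Good.angle_ge {τ : Fin 3 → Pt} {A B C : Pt} (h : Good τ A B C) (θ : Fin 3 → ℝ)
    (hθ01 : θ 0 ≤ θ 1) (hθ12 : θ 1 ≤ θ 2)
    (hangle : ∀ j : Fin 3, EuclideanGeometry.angle (τ (j + 1)) (τ j) (τ (j - 1)) = θ j) :
    θ 0 ≤ EuclideanGeometry.angle A B C := by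
  obtain ⟨i, j, k, h1, h2, h3, rfl, rfl, rfl⟩ := h
  have hj : θ 0 ≤ θ j := by
    fin_cases j <;> simp <;> linarith
  have : (i = j + 1 ∧ k = j - 1) ∨ (k = j + 1 ∧ i = j - 1) := by
    clear hj
    revert i j k; decide
  rcases this with ⟨rfl, rfl⟩ | ⟨rfl, rfl⟩
  · rw [hangle]; exact hj
  · rw [EuclideanGeometry.angle_comm, hangle]; exact hj

/-- The two-leg detour through a corner is at most `1 / sin (θ₁/2)` times the direct distance. -/
lemma two_leg {A B C : Pt} {t0 : ℝ} (h0 : 0 < t0)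
    (hang : t0 ≤ EuclideanGeometry.angle A B C) {s r : ℝ} (hs : 0 ≤ s) (hr : 0 ≤ r) :
    s * ‖B - A‖ + r * ‖C - B‖ ≤ 1 / Real.sin (t0 / 2) * ‖s • (B - A) + r • (C - B)‖ := by
  have hle := EuclideanGeometry.angle_le_pi A B C
  set φ := EuclideanGeometry.angle A B C with hφ
  have hin : inner ℝ (B - A) (C - B) = -(Real.cos φ * (‖B - A‖ * ‖C - B‖)) := by
    have h1 := InnerProductGeometry.cos_angle_mul_norm_mul_norm (A - B) (C - B)
    have h2 : Real.cos φ = Real.cos (InnerProductGeometry.angle (A - B) (C - B)) := rfl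
    rw [h2, ← neg_sub A B, inner_neg_left, norm_neg, h1]
  have hN : ‖s • (B - A) + r • (C - B)‖ ^ 2 = (s * ‖B - A‖) ^ 2 + (r * ‖C - B‖) ^ 2
      - 2 * Real.cos φ * (s * ‖B - A‖) * (r * ‖C - B‖) := by
    rw [norm_add_sq_real, norm_smul, norm_smul, inner_smul_left, inner_smul_right, hin,
      Real.norm_of_nonneg hs, Real.norm_of_nonneg hr]
    simp
    ring
  set X := s * ‖B - A‖
  set Y := r * ‖C - B‖
  have hX : 0 ≤ X := by positivity
  have hY : 0 ≤ Y := by positivity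
  have hpos : 0 < Real.sin (t0 / 2) := Real.sin_pos_of_pos_of_lt_pi (by linarith) (by linarith)
  have hmono : Real.sin (t0 / 2) ≤ Real.sin (φ / 2) :=
    Real.sin_le_sin_of_le_of_le_pi_div_two (by linarith [Real.pi_pos]) (by linarith) (by linarith)
  have hsq : Real.sin (φ / 2) ^ 2 = (1 - Real.cos φ) / 2 := by
    rw [Real.sin_sq_eq_half_sub, show 2 * (φ / 2) = φ by ring]; ring
  have key : (X + Y) * Real.sin (φ / 2) ≤ ‖s • (B - A) + r • (C - B)‖ := by
    apply le_of_sq_le_sq _ (norm_nonneg _)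
    rw [hN, mul_pow, hsq]
    nlinarith [mul_nonneg (sq_nonneg (X - Y)) (by linarith [Real.neg_one_le_cos φ] :
      (0 : ℝ) ≤ 1 + Real.cos φ)]
  rw [div_mul_eq_mul_div, one_mul, le_div_iff₀ hpos]
  exact (mul_le_mul_of_nonneg_left hmono (by positivity)).trans key

/-- There is a path of length at most `L`. -/
inductive Rch (Adj : Pt → Pt → Prop) : Pt → Pt → ℝ → Prop
  | refl (u : Pt) (L : ℝ) (h : 0 ≤ L) : Rch Adj u u L
  | step (u v w : Pt) (L M : ℝ) (h : Adj u v) (h' : Rch Adj v w L) (hM : ‖u - v‖ + L ≤ M) :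
      Rch Adj u w M

lemma Rch.mono {Adj : Pt → Pt → Prop} {u v : Pt} {L M : ℝ} (h : Rch Adj u v L) (hLM : L ≤ M) :
    Rch Adj u v M := by
  cases h with
  | refl _ _ h => exact .refl _ _ (h.trans hLM)
  | step _ v _ L _ h h' hM => exact .step _ v _ L _ h h' (hM.trans hLM)

lemma Rch.trans {Adj : Pt → Pt → Prop} {u v w : Pt} {L M : ℝ} (h : Rch Adj u v L)
    (h2 : Rch Adj v w M) : Rch Adj u w (L + M) := by
  induction h with
  | refl _ _ h => exact h2.mono (by linarith)
  | step u v _ L K h h' hM ih => exact .step u v _ _ _ h (ih h2) (by linarith)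

lemma Rch.symm {Adj : Pt → Pt → Prop} (hs : ∀ u v, Adj u v → Adj v u) {u v : Pt} {L : ℝ}
    (h : Rch Adj u v L) : Rch Adj v u L := by
  induction h with
  | refl _ _ h => exact .refl _ _ h
  | step u v _ L K h h' hM ih =>
    refine (ih.trans (.step v u u 0 ‖u - v‖ (hs _ _ h) (.refl _ _ le_rfl) ?_)).mono ?_
    · rw [norm_sub_rev]; simp
    · linarith

lemma Rch.path {Adj : Pt → Pt → Prop} {u v : Pt} {L : ℝ} (h : Rch Adj u v L) :
    ∃ P : List Pt, IsPathFrom Adj u v P ∧ pathLength P ≤ L := by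
  induction h with
  | refl u _ h => exact ⟨[u], ⟨by simp, by simp, by simp, by simp [List.Chain']⟩, by simpa [pathLength] using h⟩
  | step u v w L K h h' hM ih =>
    obtain ⟨P, ⟨h1, h2, h3, h4⟩, h5⟩ := ih
    cases P with
    | nil => exact absurd rfl h1
    | cons x P =>
      obtain rfl : x = v := by simpa using h2
      refine ⟨u :: x :: P, ⟨by simp, by simp, by simpa using h3, ?_⟩, ?_⟩
      · exact List.isChain_cons_cons.2 ⟨h, h4⟩
      · simp only [pathLength]; linarith

lemma pathLength_nonneg : ∀ P : List Pt, 0 ≤ pathLength P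
  | [] => le_rfl
  | [_] => le_rfl
  | a :: b :: rest => add_nonneg (norm_nonneg _) (pathLength_nonneg (b :: rest))

lemma Rch.dG_le {Adj : Pt → Pt → Prop} {u v : Pt} {L : ℝ} (h : Rch Adj u v L) :
    dG Adj u v ≤ L := by
  obtain ⟨P, hP, hL⟩ := h.path
  have hb : BddBelow { L : ℝ | ∃ P : List Pt, IsPathFrom Adj u v P ∧ pathLength P = L } := by
    refine ⟨0, ?_⟩
    rintro x ⟨Q, -, rfl⟩
    exact pathLength_nonneg Q
  exact (csInf_le hb ⟨P, hP, rfl⟩).trans hL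

lemma TDAdj.symm' {D S : Set Pt} (u v : Pt) (h : TDAdj D S u v) : TDAdj D S v u := by
  obtain ⟨h1, h2, h3, r, hr, w, h4, h5, h6⟩ := h
  exact ⟨h2, h1, h3.symm, r, hr, w, h5, h4, h6⟩

lemma mem_scaled {τ : Fin 3 → Pt} {A B C : Pt} (h : Good τ A B C) {m : ℝ} (hm : 0 < m)
    (u x : Pt) : x ∈ scaledTranslate (Tri τ) m (u - m • A) ↔
      ∃ a b : ℝ, 0 ≤ a ∧ 0 ≤ b ∧ a + b ≤ m ∧ x = u + a • (B - A) + b • (C - A) := by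
  unfold scaledTranslate Tri
  rw [h.range]
  simp only [Set.mem_image, convexHull_insert (Set.insert_nonempty B {C}), convexHull_pair,
    segment_eq_image, convexJoin, Set.mem_iUnion, Set.mem_singleton_iff]
  constructor
  · rintro ⟨y, ⟨_, rfl, z, ⟨t, ⟨ht0, ht1⟩, rfl⟩, ⟨k, ⟨hk0, hk1⟩, rfl⟩⟩, rfl⟩
    refine ⟨m * k * (1 - t), m * k * t, ?_, ?_, ?_, ?_⟩
    · have : 0 ≤ 1 - t := by linarith
      positivity
    · positivity
    · nlinarith
    · module
  · rintro ⟨a, b, ha, hb, hab, rfl⟩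
    rcases eq_or_lt_of_le (add_nonneg ha hb) with h0 | h0
    · obtain rfl : a = 0 := by linarith
      obtain rfl : b = 0 := by linarith
      refine ⟨A, ⟨A, rfl, B, ⟨0, by simp, by simp⟩, ⟨0, by simp, by simp⟩⟩, by module⟩
    · refine ⟨_, ⟨A, rfl, _, ⟨b / (a + b), ⟨by positivity, ?_⟩, rfl⟩,
        ⟨(a + b) / m, ⟨by positivity, ?_⟩, rfl⟩⟩, ?_⟩
      · rw [div_le_one h0]; linarith
      · rw [div_le_one hm]; linarith
      · have e1 : (1 - b / (a + b)) = a / (a + b) := by field_simp; ring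
        have e2 : 1 - (a + b) / m = (m - a - b) / m := by field_simp; ring
        rw [e1, e2]
        simp only [smul_add, smul_smul]
        rw [show m * ((m - a - b) / m) = m - a - b by field_simp,
          show m * ((a + b) / m * (a / (a + b))) = a by field_simp,
          show m * ((a + b) / m * (b / (a + b))) = b by field_simp]
        module

lemma interior_dir {T : Set Pt} {x : Pt} (hx : x ∈ interior T) (d : Pt) :
    ∃ ε : ℝ, 0 < ε ∧ x + ε • d ∈ T := by
  have hc : Continuous (fun ε : ℝ => x + ε • d) := by fun_prop
  have h1 : ∀ᶠ ε : ℝ in nhds 0, x + ε • d ∈ T := by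
    apply hc.continuousAt.eventually_mem
    simpa using mem_interior_iff_mem_nhds.1 hx
  obtain ⟨δ, hδ, hb⟩ := Metric.eventually_nhds_iff.1 h1
  exact ⟨δ / 2, by linarith, hb (by simp [abs_of_pos hδ, hδ])⟩

lemma mem_interior_scaled {τ : Fin 3 → Pt} {A B C : Pt} (h : Good τ A B C)
    (hn : ¬ Collinear ℝ (Set.range τ)) {m : ℝ} (hm : 0 < m)
    (u : Pt) {a b : ℝ}
    (hx : u + a • (B - A) + b • (C - A) ∈ interior (scaledTranslate (Tri τ) m (u - m • A))) :
    0 < a ∧ 0 < b ∧ a + b < m := by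
  have huniq : ∀ a b a' b' : ℝ, u + a • (B - A) + b • (C - A) =
      u + a' • (B - A) + b' • (C - A) → a = a' ∧ b = b' := by
    intro a b a' b' he
    have := h.indep hn (a - a') (b - b') (by
      rw [← sub_eq_zero] at he
      rw [← he]; module)
    exact ⟨by linarith [this.1], by linarith [this.2]⟩
  obtain ⟨ε, hε, h1⟩ := interior_dir hx (-(B - A) - (C - A))
  obtain ⟨δ, hδ, h2⟩ := interior_dir hx (B - A)
  rw [mem_scaled h hm] at h1 h2
  obtain ⟨a1, b1, ha1, hb1, -, e1⟩ := h1
  obtain ⟨a2, b2, ha2, hb2, hab2, e2⟩ := h2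
  have f1 := huniq (a - ε) (b - ε) a1 b1 (by rw [← e1]; module)
  have f2 := huniq (a + δ) b a2 b2 (by rw [← e2]; module)
  refine ⟨by linarith [f1.1], by linarith [f1.2], by linarith [f2.1, f2.2]⟩

/-- Existence of the nearest neighbour in a positive cone. -/
lemma exists_nbr {τ : Fin 3 → Pt} {A B C : Pt} (h : Good τ A B C)
    (hn : ¬ Collinear ℝ (Set.range τ)) {S : Finset Pt} (hgp : GenPos τ ↑S) {u w : Pt}
    (hu : u ∈ S) (hw : w ∈ S) {s r : ℝ} (hs : 0 < s) (hr : 0 < r)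
    (hwu : w = u + s • (B - A) + r • (C - A)) :
    ∃ v ∈ S, ∃ a b : ℝ, 0 < a ∧ 0 < b ∧ a + b ≤ s + r ∧ v = u + a • (B - A) + b • (C - A) ∧
      TDAdj (Tri τ) ↑S u v ∧
      ∀ x ∈ S, ∀ a' b' : ℝ, 0 < a' → 0 < b' → x = u + a' • (B - A) + b' • (C - A) →
        a + b ≤ a' + b' := by
  classical
  have huniq : ∀ a b a' b' : ℝ, u + a • (B - A) + b • (C - A) =
      u + a' • (B - A) + b' • (C - A) → a = a' ∧ b = b' := by
    intro a b a' b' he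
    have := h.indep hn (a - a') (b - b') (by
      rw [← sub_eq_zero] at he
      rw [← he]; module)
    exact ⟨by linarith [this.1], by linarith [this.2]⟩
  choose f g hfg using fun x : Pt => h.span hn (x - u)
  have hfg' : ∀ x, x = u + f x • (B - A) + g x • (C - A) := by
    intro x
    rw [add_assoc, ← hfg x]; abel
  have hfw := huniq _ _ _ _ ((hfg' w).symm.trans hwu)
  obtain ⟨v, hv, hmin⟩ := (S.filter (fun x => 0 < f x ∧ 0 < g x)).exists_min_image
    (fun x => f x + g x) ⟨w, by
      rw [Finset.mem_filter, hfw.1, hfw.2]; exact ⟨hw, hs, hr⟩⟩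
  rw [Finset.mem_filter] at hv
  obtain ⟨hvS, ha, hb⟩ := hv
  have hmin' : ∀ x ∈ S, ∀ a' b' : ℝ, 0 < a' → 0 < b' →
      x = u + a' • (B - A) + b' • (C - A) → f v + g v ≤ a' + b' := by
    intro x hx a' b' ha' hb' he
    have e := huniq _ _ _ _ ((hfg' x).symm.trans he)
    have := hmin x (by rw [Finset.mem_filter, e.1, e.2]; exact ⟨hx, ha', hb'⟩)
    simpa only [e.1, e.2] using this
  refine ⟨v, hvS, f v, g v, ha, hb, hmin' w hw s r hs hr hwu, hfg' v, ?_, hmin'⟩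
  have hm : 0 < f v + g v := by linarith
  refine ⟨hu, hvS, ?_, f v + g v, hm, u - (f v + g v) • A, ?_, ?_, ?_⟩
  · intro huv
    have := huniq 0 0 (f v) (g v) (by rw [← hfg' v, ← huv]; module)
    linarith [this.1]
  · refine ⟨subset_closure ((mem_scaled h hm u u).2
      ⟨0, 0, le_rfl, le_rfl, by linarith, by module⟩), fun hi => ?_⟩
    have := mem_interior_scaled h hn hm u (a := 0) (b := 0) (by
      convert hi using 1; module)
    exact lt_irrefl _ this.1
  · refine ⟨subset_closure ((mem_scaled h hm u v).2
      ⟨f v, g v, ha.le, hb.le, le_rfl, hfg' v⟩), fun hi => ?_⟩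
    have := mem_interior_scaled h hn hm u (a := f v) (b := g v) (by
      rw [← hfg' v]; exact hi)
    exact lt_irrefl _ this.2.2
  · intro x hx hi
    have := mem_interior_scaled h hn hm u (a := f x) (b := g x) (by
      rw [← hfg' x]; exact hi)
    have h2 := hmin' x hx _ _ this.1 this.2.1 (hfg' x)
    linarith [this.2.2]

/-- No point of `S` in the part of the triangle near corner `C`. -/
def Emp (S : Finset Pt) (u A B C : Pt) (s r : ℝ) : Prop :=
  ∀ x ∈ S, ∀ a b : ℝ, 0 ≤ a → a + b ≤ s + r → r < b → x ≠ u + a • (B - A) + b • (C - A)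

/-- The inductive claim. -/
def Claim (τ : Fin 3 → Pt) (S F : Finset Pt) : Prop :=
  ∀ (u w A B C : Pt) (s r : ℝ), u ∈ S → w ∈ S → Good τ A B C → 0 < s → 0 < r →
    w = u + s • (B - A) + r • (C - A) →
    (∀ x ∈ S, ∀ a b : ℝ, 0 ≤ a → 0 ≤ b → a + b ≤ s + r →
      x = u + a • (B - A) + b • (C - A) → x ∈ F) →
    (Emp S u A B C s r → Rch (TDAdj (Tri τ) ↑S) u w ((s + r) * ‖B - A‖ + r * ‖C - B‖)) ∧
    (Emp S u A C B r s → Rch (TDAdj (Tri τ) ↑S) u w ((s + r) * ‖C - A‖ + s * ‖C - B‖)) ∧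
    Rch (TDAdj (Tri τ) ↑S) u w
      (max ((s + r) * ‖B - A‖ + r * ‖C - B‖) ((s + r) * ‖C - A‖ + s * ‖C - B‖))

lemma leg_bound (A B C : Pt) {a b : ℝ} (ha : 0 ≤ a) (hb : 0 ≤ b) :
    ‖a • (B - A) + b • (C - A)‖ ≤ (a + b) * ‖B - A‖ + b * ‖C - B‖ := by
  have e : a • (B - A) + b • (C - A) = (a + b) • (B - A) + b • (C - B) := by module
  rw [e]
  refine (norm_add_le _ _).trans ?_
  rw [norm_smul, norm_smul, Real.norm_of_nonneg hb, Real.norm_of_nonneg (add_nonneg ha hb)]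

/-- The neighbour lies near corner `C`. -/
lemma side_case {τ : Fin 3 → Pt} (hn : ¬ Collinear ℝ (Set.range τ)) {S F : Finset Pt}
    (hgp : GenPos τ ↑S) {u w v A B C : Pt} (IH : Claim τ S (F.erase u)) {s r a b : ℝ}
    (hw : w ∈ S) (hv : v ∈ S) (hG : Good τ A B C) (hs : 0 < s) (hr : 0 < r)
    (hwu : w = u + s • (B - A) + r • (C - A))
    (hF : ∀ x ∈ S, ∀ a b : ℝ, 0 ≤ a → 0 ≤ b → a + b ≤ s + r →
      x = u + a • (B - A) + b • (C - A) → x ∈ F)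
    (ha : 0 < a) (hab : a + b ≤ s + r) (hvu : v = u + a • (B - A) + b • (C - A))
    (hadj : TDAdj (Tri τ) ↑S u v)
    (hmin : ∀ x ∈ S, ∀ a' b' : ℝ, 0 < a' → 0 < b' → x = u + a' • (B - A) + b' • (C - A) →
        a + b ≤ a' + b') (hbr : r < b) :
    Rch (TDAdj (Tri τ) ↑S) u w ((s + r) * ‖C - A‖ + s * ‖C - B‖) := by
  have hlt : a + b < s + r := by
    refine lt_of_le_of_ne hab fun he => ?_
    have hwv : w ≠ v := by
      rintro rfl
      have := hG.indep hn (s - a) (r - b) (by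
        have e := hwu.symm.trans hvu
        rw [← sub_eq_zero] at e
        rw [← e]; module)
      linarith [this.2]
    apply hG.swap12.swap23.gp hgp hw hv hwv (b - r)
    obtain rfl : a = s + r - b := by linarith
    rw [hvu, hwu]; module
  obtain ⟨-, h2, -⟩ := IH w v B A C (s + r - a - b) (b - r) hw hv hG.swap12 (by linarith)
    (by linarith) (by rw [hvu, hwu]; module) (by
      intro x hx a' b' ha' hb' hab' he
      have he' : x = u + (s - a' - b') • (B - A) + (r + b') • (C - A) := by
        rw [he, hwu]; module
      refine Finset.mem_erase.2 ⟨?_, hF x hx _ _ (by linarith) (by linarith) (by linarith) he'⟩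
      rintro rfl
      have := hG.indep hn (s - a' - b') (r + b') (by
        rw [add_assoc] at he'
        exact left_eq_add.1 he')
      linarith [this.2])
  have h3 := h2 (by
    intro x hx b' a' hb' hab' hlt' he
    have he' : x = u + (s - a' - b') • (B - A) + (r + b') • (C - A) := by
      rw [he, hwu]; module
    have := hmin x hx _ _ (by linarith) (by linarith) he'
    linarith)
  refine .step _ v _ _ _ hadj (h3.symm (TDAdj.symm')) ?_
  have hl := leg_bound A C B (a := b) (b := a) (by linarith) ha.le
  have e : ‖u - v‖ = ‖b • (C - A) + a • (B - A)‖ := by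
    rw [norm_sub_rev, hvu]; congr 1; module
  rw [e]
  rw [norm_sub_rev B C] at hl
  linarith

lemma claim_all {τ : Fin 3 → Pt} (hn : ¬ Collinear ℝ (Set.range τ)) {S : Finset Pt}
    (hgp : GenPos τ ↑S) (F : Finset Pt) : Claim τ S F := by
  induction F using Finset.strongInduction with
  | H F ih =>
  intro u w A B C s r hu hw hG hs hr hwu hF
  have huF : u ∈ F := hF u hu 0 0 le_rfl le_rfl (by linarith) (by module)
  have IH := ih _ (Finset.erase_ssubset huF)
  obtain ⟨v, hv, a, b, ha, hb, hab, hvu, hadj, hmin⟩ := exists_nbr hG hn hgp hu hw hs hr hwu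
  have hwu' : w = u + r • (C - A) + s • (B - A) := by rw [hwu]; module
  have hvu' : v = u + b • (C - A) + a • (B - A) := by rw [hvu]; module
  by_cases hbr : r < b
  · have h1 := side_case hn hgp IH hw hv hG hs hr hwu hF ha hab hvu hadj hmin hbr
    exact ⟨fun hE => absurd hvu (hE v hv a b ha.le hab hbr), fun _ => h1,
      h1.mono (le_max_right _ _)⟩
  by_cases has : s < a
  · have h1 := side_case hn hgp IH hw hv hG.swap23 hr hs hwu'
      (fun x hx a b h1 h2 h3 h4 => hF x hx b a h2 h1 (by linarith) (by rw [h4]; module))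
      hb (by linarith) hvu' hadj
      (fun x hx a b h1 h2 h3 => by
        have := hmin x hx b a h2 h1 (by rw [h3]; module)
        linarith) has
    rw [norm_sub_rev B C, add_comm r s] at h1
    exact ⟨fun _ => h1, fun hE => absurd hvu' (hE v hv b a hb.le (by linarith) has),
      h1.mono (le_max_left _ _)⟩
  push Not at hbr has
  have e : ‖u - v‖ = ‖a • (B - A) + b • (C - A)‖ := by
    rw [norm_sub_rev, hvu]; congr 1; module
  have e' : ‖u - v‖ = ‖b • (C - A) + a • (B - A)‖ := by
    rw [e, add_comm]
  have l1 := leg_bound A B C ha.le hb.le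
  have l2 := leg_bound A C B hb.le ha.le
  rw [← e] at l1
  rw [← e', norm_sub_rev B C] at l2
  have n1 := norm_nonneg (B - A)
  have n2 := norm_nonneg (C - A)
  have n3 := norm_nonneg (C - B)
  by_cases hvw : v = w
  · subst hvw
    have hd : Rch (TDAdj (Tri τ) ↑S) u v ‖u - v‖ :=
      .step _ v _ 0 _ hadj (.refl _ _ le_rfl) (by simp)
    have m1 : ‖u - v‖ ≤ (s + r) * ‖B - A‖ + r * ‖C - B‖ := l1.trans (by gcongr)
    have m2 : ‖u - v‖ ≤ (s + r) * ‖C - A‖ + s * ‖C - B‖ := l2.trans (by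
      rw [add_comm b a]; gcongr)
    exact ⟨fun _ => hd.mono m1, fun _ => hd.mono m2, hd.mono (m1.trans (le_max_left _ _))⟩
  have has' : a < s := by
    refine lt_of_le_of_ne has fun he => ?_
    apply hG.swap23.gp hgp hv hw hvw (r - b)
    rw [hwu, hvu, he]; module
  have hbr' : b < r := by
    refine lt_of_le_of_ne hbr fun he => ?_
    apply hG.gp hgp hv hw hvw (s - a)
    rw [hwu, hvu, he]; module
  obtain ⟨c1, c2, c3⟩ := IH v w A B C (s - a) (r - b) hv hw hG (by linarith) (by linarith)
    (by rw [hwu, hvu]; module) (by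
      intro x hx a' b' ha' hb' hab' he
      have he' : x = u + (a + a') • (B - A) + (b + b') • (C - A) := by
        rw [he, hvu]; module
      refine Finset.mem_erase.2 ⟨?_, hF x hx _ _ (by linarith) (by linarith) (by linarith) he'⟩
      rintro rfl
      have := hG.indep hn (a + a') (b + b') (by
        rw [add_assoc] at he'
        exact left_eq_add.1 he')
      linarith [this.2])
  refine ⟨fun hE => ?_, fun hE => ?_, ?_⟩
  · refine .step _ v _ _ _ hadj (c1 ?_) (by linarith)
    intro x hx a' b' ha' hab' hb' he
    exact hE x hx (a + a') (b + b') (by linarith) (by linarith) (by linarith)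
      (by rw [he, hvu]; module)
  · refine .step _ v _ _ _ hadj (c2 ?_) (by linarith)
    intro x hx b' a' hb' hab' ha' he
    exact hE x hx (b + b') (a + a') (by linarith) (by linarith) (by linarith)
      (by rw [he, hvu]; module)
  · refine .step _ v _ _ _ hadj c3 ?_
    rw [← max_add_add_left]
    exact max_le_max (by linarith) (by linarith)

lemma cone_bound {θ : Fin 3 → ℝ} (hθ0 : 0 < θ 0) (hθ01 : θ 0 ≤ θ 1) (hθ12 : θ 1 ≤ θ 2)
    {τ : Fin 3 → Pt} (hn : ¬ Collinear ℝ (Set.range τ))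
    (hangle : ∀ j : Fin 3, EuclideanGeometry.angle (τ (j + 1)) (τ j) (τ (j - 1)) = θ j)
    {S : Finset Pt} (hgp : GenPos τ ↑S) {u w A B C : Pt} (hu : u ∈ S) (hw : w ∈ S)
    (hG : Good τ A B C) {s r : ℝ} (hs : 0 < s) (hr : 0 < r)
    (hwu : w - u = s • (B - A) + r • (C - A)) :
    Rch (TDAdj (Tri τ) ↑S) u w (1 / Real.sin (θ 0 / 2) * ‖u - w‖) := by
  have h1 := (claim_all hn hgp S u w A B C s r hu hw hG hs hr
    (by rw [add_assoc, ← hwu]; abel) (fun x hx _ _ _ _ _ _ => hx)).2.2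
  refine h1.mono (max_le ?_ ?_)
  · have := two_leg hθ0 (hG.angle_ge θ hθ01 hθ12 hangle) (s := s + r) (r := r)
      (by linarith) hr.le
    rw [norm_sub_rev u w, hwu, show s • (B - A) + r • (C - A)
      = (s + r) • (B - A) + r • (C - B) by module]
    exact this
  · have := two_leg hθ0 (hG.swap23.angle_ge θ hθ01 hθ12 hangle) (s := s + r) (r := s)
      (by linarith) hs.le
    rw [norm_sub_rev B C] at this
    rw [norm_sub_rev u w, hwu, show s • (B - A) + r • (C - A)
      = (s + r) • (C - A) + s • (B - C) by module]
    exact this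

lemma pair_bound {θ : Fin 3 → ℝ} (hθ0 : 0 < θ 0) (hθ01 : θ 0 ≤ θ 1) (hθ12 : θ 1 ≤ θ 2)
    {τ : Fin 3 → Pt} (hn : ¬ Collinear ℝ (Set.range τ))
    (hangle : ∀ j : Fin 3, EuclideanGeometry.angle (τ (j + 1)) (τ j) (τ (j - 1)) = θ j)
    {S : Finset Pt} (hgp : GenPos τ ↑S) {u w : Pt} (hu : u ∈ S) (hw : w ∈ S) (huw : u ≠ w) :
    Rch (TDAdj (Tri τ) ↑S) u w (1 / Real.sin (θ 0 / 2) * ‖u - w‖) := by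
  have hG : Good τ (τ 0) (τ 1) (τ 2) := ⟨0, 1, 2, by decide, by decide, by decide, rfl, rfl, rfl⟩
  generalize τ 0 = A at hG
  generalize τ 1 = B at hG
  generalize τ 2 = C at hG
  obtain ⟨a, b, hab⟩ := hG.span hn (w - u)
  have hba : u - w = (-a) • (B - A) + (-b) • (C - A) := by
    rw [← neg_sub w u, hab]; module
  have hb0 : b ≠ 0 := by
    rintro rfl
    exact hG.gp hgp hu hw huw a (by rw [hab]; module)
  have ha0 : a ≠ 0 := by
    rintro rfl
    exact hG.swap23.gp hgp hu hw huw b (by rw [hab]; module)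
  have hab0 : a + b ≠ 0 := by
    intro h
    obtain rfl : a = -b := by linarith
    exact hG.swap12.swap23.gp hgp hu hw huw b (by rw [hab]; module)
  have fwd : ∀ {A B C : Pt} {s r : ℝ}, Good τ A B C → 0 < s → 0 < r →
      w - u = s • (B - A) + r • (C - A) →
      Rch (TDAdj (Tri τ) ↑S) u w (1 / Real.sin (θ 0 / 2) * ‖u - w‖) := by
    intro A B C s r hG hs hr he
    exact cone_bound hθ0 hθ01 hθ12 hn hangle hgp hu hw hG hs hr he
  have bwd : ∀ {A B C : Pt} {s r : ℝ}, Good τ A B C → 0 < s → 0 < r →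
      u - w = s • (B - A) + r • (C - A) →
      Rch (TDAdj (Tri τ) ↑S) u w (1 / Real.sin (θ 0 / 2) * ‖u - w‖) := by
    intro A B C s r hG hs hr he
    rw [norm_sub_rev]
    exact (cone_bound hθ0 hθ01 hθ12 hn hangle hgp hw hu hG hs hr he).symm TDAdj.symm'
  have hGB : Good τ B A C := hG.swap12
  have hGC : Good τ C A B := hG.swap23.swap12
  rcases lt_or_gt_of_ne ha0 with ha | ha <;> rcases lt_or_gt_of_ne hb0 with hb | hb
  · exact bwd hG (neg_pos.2 ha) (neg_pos.2 hb) hba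
  · rcases lt_or_gt_of_ne hab0 with hc | hc
    · exact fwd (s := -(a + b)) (r := b) hGB (by linarith) hb (by rw [hab]; module)
    · exact bwd (s := a + b) (r := -a) hGC (by linarith) (by linarith) (by rw [hba]; module)
  · rcases lt_or_gt_of_ne hab0 with hc | hc
    · exact fwd (s := -(a + b)) (r := a) hGC (by linarith) (by linarith) (by rw [hab]; module)
    · exact bwd (s := a + b) (r := -b) hGB (by linarith) (by linarith) (by rw [hba]; module)
  · exact fwd hG ha hb hab

/-- The `TD_{θ₁,θ₂}`-Delaunay graph of a finite point set in general
position is connected, and its stretch is at most `max(1/sin(θ₁/2), C(θ₁,θ₂))`. -/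
theorem td_delaunay_spanner
    (θ : Fin 3 → ℝ) (hθ0 : 0 < θ 0) (hθ01 : θ 0 ≤ θ 1) (hθ12 : θ 1 ≤ θ 2)
    (hsum : θ 0 + θ 1 + θ 2 = Real.pi)
    (τ : Fin 3 → Pt) (hncol : ¬ Collinear ℝ (Set.range τ))
    (hangle : ∀ j : Fin 3, EuclideanGeometry.angle (τ (j + 1)) (τ j) (τ (j - 1)) = θ j)
    (S : Finset Pt) (hgp : GenPos τ ↑S) :
    ∀ s ∈ S, ∀ t ∈ S,
      (∃ P : List Pt, IsPathFrom (TDAdj (Tri τ) ↑S) s t P) ∧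
      dG (TDAdj (Tri τ) ↑S) s t ≤
        max (1 / Real.sin (θ 0 / 2)) (Cval θ) * ‖s - t‖ := by
  intro s hs t ht
  have hR : Rch (TDAdj (Tri τ) ↑S) s t
      (max (1 / Real.sin (θ 0 / 2)) (Cval θ) * ‖s - t‖) := by
    by_cases hst : s = t
    · subst hst
      exact .refl _ _ (by simp)
    · exact (pair_bound hθ0 hθ01 hθ12 hncol hangle hgp hs ht hst).mono
        (mul_le_mul_of_nonneg_right (le_max_left _ _) (norm_nonneg _))
  obtain ⟨P, hP, -⟩ := hR.path
  exact ⟨⟨P, hP⟩, hR.dG_le⟩
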